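/- Let n ≥ 1, let r ∈ ℕ, and let f_m, f : ℝⁿ → ℂ be C^r functions such that f_m → f in C^r on compact subsets of ℝⁿ (i.e., all partial derivatives of order ≤ r converge uniformly on every compact set). Let K_j^{(m)}, K_j (j = 1, …, s) be convex bodies in ℝⁿ with K_j^{(m)} → K_j in the Hausdorff metric as m → ∞. Then the functions g_m(λ_1, …, λ_s) := ∫_{λ_1 K_1^{(m)} + ⋯ + λ_s K_s^{(m)}} f_m(x) dx converge to g(λ) := ∫_{λ_1 K_1 + ⋯ + λ_s K_s} f(x) dx in C^r on compact subsets of the closed orthant ℝ_{≥0}^s: all partial derivatives of order ≤ r (one-sided at the boundary) converge uniformly on every compact subset of ℝ_{≥0}^s. -/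

import Mathlib

open scoped Pointwise ContDiff
open MeasureTheory Set Filter

noncomputable section

/-- Euclidean space `ℝⁿ`. -/
abbrev Euc (n : ℕ) := EuclideanSpace ℝ (Fin n)

section Helpers

open scoped RealInnerProductSpace Topology

namespace ConvexBody

variable {n : ℕ}

lemma exists_metric_projection (K : ConvexBody (Euc n)) (x : Euc n) :
    ∃ p ∈ K, ∀ w ∈ K, ⟪x - p, w - p⟫ ≤ 0 := by
  obtain ⟨p, hp, h⟩ := exists_norm_eq_iInf_of_complete_convex K.nonempty
    K.isCompact.isComplete K.convex x
  exact ⟨p, hp, (norm_eq_iInf_iff_real_inner_le_zero K.convex hp).1 h⟩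

/-- The nearest point of a convex body. -/
def metricProj (K : ConvexBody (Euc n)) (x : Euc n) : Euc n :=
  (K.exists_metric_projection x).choose

lemma metricProj_mem (K : ConvexBody (Euc n)) (x : Euc n) : K.metricProj x ∈ K :=
  (K.exists_metric_projection x).choose_spec.1

lemma inner_sub_metricProj_le (K : ConvexBody (Euc n)) (x : Euc n) {w : Euc n} (hw : w ∈ K) :
    ⟪x - K.metricProj x, w - K.metricProj x⟫ ≤ 0 :=
  (K.exists_metric_projection x).choose_spec.2 w hw

lemma sq_norm_metricProj_sub_le (K : ConvexBody (Euc n)) (x y : Euc n) :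
    ‖K.metricProj x - K.metricProj y‖ ^ 2 ≤ ⟪K.metricProj x - K.metricProj y, x - y⟫ := by
  have h1 := K.inner_sub_metricProj_le x (K.metricProj_mem y)
  have h2 := K.inner_sub_metricProj_le y (K.metricProj_mem x)
  rw [← real_inner_self_eq_norm_sq]
  simp only [inner_sub_left, inner_sub_right, real_inner_comm] at *
  linarith

lemma inner_metricProj_sub_nonneg (K : ConvexBody (Euc n)) (x y : Euc n) :
    0 ≤ ⟪K.metricProj x - K.metricProj y, x - y⟫ :=
  (sq_nonneg _).trans (K.sq_norm_metricProj_sub_le x y)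

lemma lipschitzWith_metricProj (K : ConvexBody (Euc n)) : LipschitzWith 1 K.metricProj := by
  refine LipschitzWith.of_dist_le_mul fun x y => ?_
  rw [dist_eq_norm, dist_eq_norm, NNReal.coe_one, one_mul]
  have h := (K.sq_norm_metricProj_sub_le x y).trans (real_inner_le_norm _ _)
  by_contra! hlt
  nlinarith [norm_nonneg (x - y)]

lemma metricProj_eq_of_forall_inner_le (K : ConvexBody (Euc n)) {x p : Euc n} (hp : p ∈ K)
    (h : ∀ w ∈ K, ⟪x - p, w - p⟫ ≤ 0) : K.metricProj x = p := by
  have h1 := h _ (K.metricProj_mem x)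
  have h2 := K.inner_sub_metricProj_le x hp
  rw [← sub_eq_zero, ← real_inner_self_nonpos]
  set q := K.metricProj x
  have : (⟪q - p, q - p⟫ : ℝ) = ⟪x - p, q - p⟫ + ⟪x - q, p - q⟫ := by
    rw [show x - q = (x - p) - (q - p) by abel, show p - q = -(q - p) by abel, inner_neg_right,
      inner_sub_left (x - p) (q - p) (q - p)]
    ring
  linarith

/-- The fibres of the metric projection are convex. -/
lemma metricProj_add_smul_sub (K : ConvexBody (Euc n)) {x y : Euc n}
    (h : K.metricProj x = K.metricProj y) {t : ℝ} (ht : t ∈ Icc (0 : ℝ) 1) :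
    K.metricProj (x + t • (y - x)) = K.metricProj x := by
  refine K.metricProj_eq_of_forall_inner_le (K.metricProj_mem x) fun w hw => ?_
  have h1 := K.inner_sub_metricProj_le x hw
  have h2 := K.inner_sub_metricProj_le y hw
  rw [← h] at h2
  set p := K.metricProj x
  rw [show x + t • (y - x) - p = (1 - t) • (x - p) + t • (y - p) by module, inner_add_left,
    real_inner_smul_left, real_inner_smul_left]
  nlinarith [ht.1, ht.2]

lemma exists_dist_le_dist (K L : ConvexBody (Euc n)) {p : Euc n} (hp : p ∈ K) :
    ∃ q ∈ L, dist p q ≤ dist K L := by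
  obtain ⟨q, hq, h⟩ := L.isCompact.exists_infDist_eq_dist L.nonempty p
  refine ⟨q, hq, ?_⟩
  rw [← h, ← hausdorffDist_coe]
  exact Metric.infDist_le_hausdorffDist_of_mem hp hausdorffEDist_ne_top

lemma sq_norm_metricProj_sub_metricProj_le (K L : ConvexBody (Euc n)) (x : Euc n) :
    ‖K.metricProj x - L.metricProj x‖ ^ 2 ≤
      (‖x - K.metricProj x‖ + ‖x - L.metricProj x‖) * dist K L := by
  set p := K.metricProj x with hp
  set q := L.metricProj x with hq
  obtain ⟨p', hp', h1⟩ := K.exists_dist_le_dist L (K.metricProj_mem x)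
  obtain ⟨q', hq', h2⟩ := L.exists_dist_le_dist K (L.metricProj_mem x)
  have h3 := K.inner_sub_metricProj_le x hq'
  have h4 := L.inner_sub_metricProj_le x hp'
  rw [← hp] at h1 h3
  rw [← hq] at h2 h4
  rw [dist_comm L K] at h2
  rw [dist_eq_norm] at h1 h2
  have h5 := (real_inner_le_norm (x - p) (q - q')).trans
    (mul_le_mul_of_nonneg_left h2 (norm_nonneg _))
  have h6 := (real_inner_le_norm (x - q) (p - p')).trans
    (mul_le_mul_of_nonneg_left h1 (norm_nonneg _))
  have h7 : ‖p - q‖ ^ 2 = ⟪x - p, q' - p⟫ + ⟪x - p, q - q'⟫ + (⟪x - q, p' - q⟫ +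
      ⟪x - q, p - p'⟫) := by
    rw [← inner_add_right, ← inner_add_right, ← real_inner_self_eq_norm_sq,
      show q' - p + (q - q') = -(p - q) by abel, show p' - q + (p - p') = p - q by abel,
      inner_neg_right, ← sub_eq_neg_add, ← inner_sub_left]
    congr 1
    abel
  rw [h7]
  linarith

end ConvexBody

namespace ConvexBody

variable {n s : ℕ} {lam : Fin s → ℝ} {K : Fin s → ConvexBody (Euc n)}

lemma mem_sum_smul_iff {y : Euc n} : y ∈ (∑ i, lam i • (K i : Set (Euc n))) ↔
    ∃ k : Fin s → Euc n, (∀ i, k i ∈ K i) ∧ ∑ i, lam i • k i = y := by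
  rw [Set.mem_fintype_sum]
  constructor
  · rintro ⟨g, hg, rfl⟩
    choose k hk h using fun i => Set.mem_smul_set.1 (hg i)
    exact ⟨k, hk, Finset.sum_congr rfl fun i _ => h i⟩
  · rintro ⟨k, hk, rfl⟩
    exact ⟨fun i => lam i • k i, fun i => Set.smul_mem_smul_set (hk i), rfl⟩

lemma isCompact_sum_smul (lam : Fin s → ℝ) (K : Fin s → ConvexBody (Euc n)) :
    IsCompact (∑ i, lam i • (K i : Set (Euc n))) := by
  have h : (∑ i, lam i • (K i : Set (Euc n))) =
      (fun k : Fin s → Euc n => ∑ i, lam i • k i) '' univ.pi fun i => (K i : Set (Euc n)) := by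
    ext y
    simp [mem_sum_smul_iff]
  rw [h]
  exact (isCompact_univ_pi fun i => (K i).isCompact).image (by fun_prop)

lemma convex_sum_smul (lam : Fin s → ℝ) (K : Fin s → ConvexBody (Euc n)) :
    Convex ℝ (∑ i, lam i • (K i : Set (Euc n))) := by
  rintro x hx y hy a b ha hb hab
  rw [mem_sum_smul_iff] at *
  obtain ⟨k, hk, rfl⟩ := hx
  obtain ⟨l, hl, rfl⟩ := hy
  refine ⟨fun i => a • k i + b • l i, fun i => (K i).convex (hk i) (hl i) ha hb hab, ?_⟩
  rw [Finset.smul_sum, Finset.smul_sum, ← Finset.sum_add_distrib]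
  exact Finset.sum_congr rfl fun i _ => by module

/-- The linear combination of the metric projections onto a family of convex bodies. -/
def projComb (lam : Fin s → ℝ) (K : Fin s → ConvexBody (Euc n)) (x : Euc n) : Euc n :=
  ∑ i, lam i • (K i).metricProj x

lemma projComb_mem (lam : Fin s → ℝ) (K : Fin s → ConvexBody (Euc n)) (x : Euc n) :
    projComb lam K x ∈ (∑ i, lam i • (K i : Set (Euc n))) :=
  mem_sum_smul_iff.2 ⟨fun i => (K i).metricProj x, fun i => (K i).metricProj_mem x, rfl⟩

lemma exists_lipschitzWith_projComb (lam : Fin s → ℝ) (K : Fin s → ConvexBody (Euc n)) :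
    ∃ C, LipschitzWith C (projComb lam K) := by
  have h : ∀ t : Finset (Fin s), ∃ C,
      LipschitzWith C fun x => ∑ i ∈ t, lam i • (K i).metricProj x := by
    intro t
    induction t using Finset.induction_on with
    | empty => exact ⟨0, by simp⟩
    | insert a t ha ih =>
      obtain ⟨C, hC⟩ := ih
      simp only [Finset.sum_insert ha]
      exact ⟨_, ((lipschitzWith_smul (lam a)).comp (K a).lipschitzWith_metricProj).add hC⟩
  exact h Finset.univ

lemma continuous_projComb (lam : Fin s → ℝ) (K : Fin s → ConvexBody (Euc n)) :
    Continuous (projComb lam K) :=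
  (exists_lipschitzWith_projComb lam K).choose_spec.continuous

lemma sum_mul_sq_norm_metricProj_sub_le (hlam : ∀ i, 0 ≤ lam i) (x y : Euc n) :
    ∑ i, lam i * ‖(K i).metricProj x - (K i).metricProj y‖ ^ 2 ≤
      ⟪projComb lam K x - projComb lam K y, x - y⟫ := by
  rw [projComb, projComb, ← Finset.sum_sub_distrib, sum_inner]
  refine Finset.sum_le_sum fun i _ => ?_
  rw [← smul_sub, real_inner_smul_left]
  exact mul_le_mul_of_nonneg_left ((K i).sq_norm_metricProj_sub_le x y) (hlam i)

lemma metricProj_eq_of_projComb_eq (hlam : ∀ i, 0 ≤ lam i) {x y : Euc n}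
    (h : projComb lam K x = projComb lam K y) {i : Fin s} (hi : lam i ≠ 0) :
    (K i).metricProj x = (K i).metricProj y := by
  have h1 := sum_mul_sq_norm_metricProj_sub_le (K := K) hlam x y
  rw [h, sub_self, inner_zero_left] at h1
  have h2 := (Finset.sum_eq_zero_iff_of_nonneg fun i _ => mul_nonneg (hlam i) (sq_nonneg _)).1
    (h1.antisymm (Finset.sum_nonneg fun i _ => mul_nonneg (hlam i) (sq_nonneg _))) i
    (Finset.mem_univ i)
  simpa [hi, sub_eq_zero] using h2

lemma projComb_add_smul_sub (hlam : ∀ i, 0 ≤ lam i) {x y : Euc n}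
    (h : projComb lam K x = projComb lam K y) {t : ℝ} (ht : t ∈ Icc (0 : ℝ) 1) :
    projComb lam K (x + t • (y - x)) = projComb lam K x := by
  refine Finset.sum_congr rfl fun i _ => ?_
  by_cases hi : lam i = 0
  · simp [hi]
  · rw [(K i).metricProj_add_smul_sub (metricProj_eq_of_projComb_eq hlam h hi) ht]

/-- A point `y` lies at depth `ε` in the Minkowski combination: the support function of the
combination about `y` is at least `ε` times the norm. -/
def IsDeep (lam : Fin s → ℝ) (K : Fin s → ConvexBody (Euc n)) (ε : ℝ) (y : Euc n) : Prop :=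
  ∀ x : Euc n, ∃ k : Fin s → Euc n, (∀ i, k i ∈ K i) ∧ ε * ‖x‖ ≤ ⟪x, ∑ i, lam i • k i - y⟫

lemma exists_isDeep_of_mem_interior {y : Euc n}
    (hy : y ∈ interior (∑ i, lam i • (K i : Set (Euc n)))) : ∃ ε > 0, IsDeep lam K ε y := by
  obtain ⟨ε, hε, h⟩ := Metric.nhds_basis_closedBall.mem_iff.1 (mem_interior_iff_mem_nhds.1 hy)
  refine ⟨ε, hε, fun x => ?_⟩
  have hz : y + (ε * ‖x‖⁻¹) • x ∈ Metric.closedBall y ε := by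
    rw [mem_closedBall_iff_norm, add_sub_cancel_left, norm_smul, norm_mul, norm_inv, norm_norm,
      Real.norm_of_nonneg hε.le, mul_assoc]
    exact mul_le_of_le_one_right hε.le (inv_mul_le_one_of_le₀ le_rfl (norm_nonneg _))
  obtain ⟨k, hk, h⟩ := mem_sum_smul_iff.1 (h hz)
  refine ⟨k, hk, le_of_eq ?_⟩
  rw [h, add_sub_cancel_left, real_inner_smul_right, real_inner_self_eq_norm_sq]
  rcases eq_or_ne ‖x‖ 0 with h0 | h0
  · simp [h0]
  · field_simp

/-- A bound for all points of the bodies of a family. -/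
def BoundedBy (K : Fin s → ConvexBody (Euc n)) (R : ℝ) : Prop := ∀ i, ∀ x ∈ K i, ‖x‖ ≤ R

lemma exists_boundedBy (K : Fin s → ConvexBody (Euc n)) : ∃ R > 0, BoundedBy K R := by
  choose R hR using fun i => (K i).isBounded.exists_norm_le
  refine ⟨∑ i, |R i| + 1, by positivity, fun i x hx => (hR i x hx).trans ((le_abs_self _).trans ?_)⟩
  have := Finset.single_le_sum (fun i _ => abs_nonneg (R i)) (Finset.mem_univ i)
  linarith

lemma IsDeep.mul_norm_le (hlam : ∀ i, 0 ≤ lam i) {ε R : ℝ} {x : Euc n} (hR : BoundedBy K R)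
    (h : IsDeep lam K ε (projComb lam K x)) : ε * ‖x‖ ≤ (∑ i, lam i) * (2 * R ^ 2) := by
  obtain ⟨k, hk, h⟩ := h x
  refine h.trans ?_
  rw [projComb, ← Finset.sum_sub_distrib, inner_sum, Finset.sum_mul]
  refine Finset.sum_le_sum fun i _ => ?_
  rw [← smul_sub, real_inner_smul_right]
  refine mul_le_mul_of_nonneg_left ?_ (hlam i)
  have h1 := (K i).inner_sub_metricProj_le x (hk i)
  rw [inner_sub_left] at h1
  have h2 := real_inner_le_norm ((K i).metricProj x) (k i - (K i).metricProj x)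
  have h3 := hR i _ ((K i).metricProj_mem x)
  have h4 := norm_sub_le (k i) ((K i).metricProj x)
  have h5 := hR i _ (hk i)
  have h6 : ‖(K i).metricProj x‖ * ‖k i - (K i).metricProj x‖ ≤ R * (2 * R) :=
    mul_le_mul h3 (by linarith) (norm_nonneg _) ((norm_nonneg _).trans h3)
  linarith

/-- The convex potential of the metric projection. -/
def projPotential (K : ConvexBody (Euc n)) (x : Euc n) : ℝ :=
  ⟪x, K.metricProj x⟫ - ‖K.metricProj x‖ ^ 2 / 2

lemma inner_sub_le_projPotential (K : ConvexBody (Euc n)) (x : Euc n) {k : Euc n} (hk : k ∈ K) :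
    ⟪x, k⟫ - ‖k‖ ^ 2 / 2 ≤ K.projPotential x := by
  have h := K.inner_sub_metricProj_le x hk
  rw [projPotential]
  set p := K.metricProj x
  have h2 := norm_sub_sq_real k p
  simp only [inner_sub_left, inner_sub_right, real_inner_self_eq_norm_sq] at h
  rw [real_inner_comm p k] at h2
  nlinarith [sq_nonneg ‖k - p‖, real_inner_comm p k]

lemma projPotential_le (K : ConvexBody (Euc n)) (x v : Euc n) :
    K.projPotential (x + v) ≤ K.projPotential x + ⟪K.metricProj (x + v), v⟫ := by
  have h := K.inner_sub_le_projPotential x (K.metricProj_mem (x + v))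
  have h2 : K.projPotential (x + v) =
    ⟪x, K.metricProj (x + v)⟫ - ‖K.metricProj (x + v)‖ ^ 2 / 2 + ⟪K.metricProj (x + v), v⟫ := by
    rw [projPotential, inner_add_left, real_inner_comm _ v]
    ring
  linarith

lemma continuous_projPotential (K : ConvexBody (Euc n)) : Continuous K.projPotential := by
  have := K.lipschitzWith_metricProj.continuous
  unfold projPotential
  fun_prop

lemma IsDeep.exists_projComb_eq (hlam : ∀ i, 0 ≤ lam i) {ε : ℝ} (hε : 0 < ε) {y : Euc n}
    (h : IsDeep lam K ε y) : ∃ x, projComb lam K x = y := by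
  obtain ⟨R, -, hR⟩ := exists_boundedBy K
  set Φ : Euc n → ℝ := fun x => ∑ i, lam i * (K i).projPotential x - ⟪x, y⟫ with hΦ
  have hc : Continuous Φ := by
    have := fun i => (K i).continuous_projPotential
    fun_prop
  have hlow : ∀ x, ε * ‖x‖ + -(∑ i, lam i * (R ^ 2 / 2)) ≤ Φ x := by
    intro x
    obtain ⟨k, hk, hx⟩ := h x
    have h1 : ∑ i, lam i * (⟪x, k i⟫ - R ^ 2 / 2) ≤ ∑ i, lam i * (K i).projPotential x := by
      refine Finset.sum_le_sum fun i _ => mul_le_mul_of_nonneg_left ?_ (hlam i)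
      refine le_trans ?_ ((K i).inner_sub_le_projPotential x (hk i))
      have := hR i _ (hk i)
      gcongr
    simp only [mul_sub, Finset.sum_sub_distrib] at h1
    rw [inner_sub_right, inner_sum] at hx
    simp only [real_inner_smul_right] at hx
    simp only [hΦ]
    linarith
  have hcoer : Tendsto Φ (cocompact (Euc n)) atTop :=
    tendsto_atTop_mono hlow (tendsto_atTop_add_const_right _ _
      ((tendsto_norm_cocompact_atTop (E := Euc n)).const_mul_atTop hε))
  obtain ⟨x, hx⟩ := hc.exists_forall_le hcoer
  refine ⟨x, ?_⟩
  have hdir : ∀ v : Euc n, 0 ≤ ⟪projComb lam K x - y, v⟫ := by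
    intro v
    have hstep : ∀ t : ℝ, 0 < t → 0 ≤ ⟪projComb lam K (x + t • v) - y, v⟫ := by
      intro t ht
      have h1 := hx (x + t • v)
      have h2 : ∑ i, lam i * (K i).projPotential (x + t • v) ≤
          ∑ i, lam i * ((K i).projPotential x + ⟪(K i).metricProj (x + t • v), t • v⟫) :=
        Finset.sum_le_sum fun i _ =>
          mul_le_mul_of_nonneg_left ((K i).projPotential_le x (t • v)) (hlam i)
      have h3 : ∑ i, lam i * ⟪(K i).metricProj (x + t • v), t • v⟫ =
          t * ⟪projComb lam K (x + t • v), v⟫ := by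
        rw [projComb, sum_inner, Finset.mul_sum]
        exact Finset.sum_congr rfl fun i _ => by
          rw [real_inner_smul_left, real_inner_smul_right]; ring
      simp only [mul_add, Finset.sum_add_distrib] at h2
      simp only [hΦ, inner_add_left] at h1
      rw [real_inner_smul_left, real_inner_comm y v] at h1
      rw [inner_sub_left]
      refine nonneg_of_mul_nonneg_right (a := t) ?_ ht
      linarith
    have hcont : Continuous fun t : ℝ => (⟪projComb lam K (x + t • v) - y, v⟫ : ℝ) := by
      have := continuous_projComb lam K
      fun_prop
    have hlim := (hcont.tendsto 0).mono_left (nhdsWithin_le_nhds (s := Ioi 0))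
    simp only [zero_smul, add_zero] at hlim
    exact ge_of_tendsto hlim (eventually_mem_nhdsWithin.mono hstep)
  have h0 := hdir (-(projComb lam K x - y))
  rw [inner_neg_right, neg_nonneg, real_inner_self_nonpos, sub_eq_zero] at h0
  exact h0

end ConvexBody

lemma ContinuousLinearMap.det_nonneg_of_inner_nonneg {n : ℕ} (A : Euc n →L[ℝ] Euc n)
    (hA : ∀ v, 0 ≤ ⟪A v, v⟫) : 0 ≤ A.det := by
  by_contra! hneg
  set φ : ℝ → ℝ := fun t => (A + t • (1 - A)).det with hφ
  have hc : Continuous φ := ContinuousLinearMap.continuous_det.comp (by fun_prop)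
  have h0 : φ 0 < 0 := by
    have h : A + (0 : ℝ) • (1 - A) = A := by rw [zero_smul ℝ (1 - A), add_zero]
    simpa only [hφ, h] using hneg
  have h1 : φ 1 = 1 := by
    simp only [hφ, one_smul, add_sub_cancel]
    exact LinearMap.det_id
  obtain ⟨t, ht, htz⟩ := intermediate_value_Icc zero_le_one hc.continuousOn
    (show (0 : ℝ) ∈ Icc (φ 0) (φ 1) from ⟨h0.le, by rw [h1]; exact zero_le_one⟩)
  have ht0 : 0 < t := lt_of_le_of_ne ht.1 (by rintro rfl; exact h0.ne htz)
  obtain ⟨v, hv, hv0⟩ : ∃ v ∈ LinearMap.ker ((A + t • (1 - A) : Euc n →L[ℝ] Euc n) :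
      Euc n →ₗ[ℝ] Euc n), v ≠ 0 := (Submodule.ne_bot_iff _).1
    (LinearMap.bot_lt_ker_of_det_eq_zero htz).ne'
  have h2 : (⟪(A + t • (1 - A)) v, v⟫ : ℝ) = 0 := by
    rw [show (A + t • (1 - A)) v = 0 from hv, inner_zero_left]
  have h3 : (A + t • (1 - A)) v = (1 - t) • A v + t • v := by
    simp
    module
  rw [h3, inner_add_left, real_inner_smul_left, real_inner_smul_left] at h2
  have h4 : 0 < (⟪v, v⟫ : ℝ) := real_inner_self_pos.2 hv0
  nlinarith [mul_nonneg (sub_nonneg.2 ht.2) (hA v), mul_pos ht0 h4]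

lemma LipschitzWith.volume_image_eq_zero {n : ℕ} {C : NNReal} {T : Euc n → Euc n}
    (hT : LipschitzWith C T) {S : Set (Euc n)} (hS : volume S = 0) : volume (T '' S) = 0 := by
  have h1 : (Measure.hausdorffMeasure n : Measure (Euc n)) S = 0 :=
    Measure.absolutelyContinuous_isAddHaarMeasure (Measure.hausdorffMeasure n) volume hS
  refine Measure.absolutelyContinuous_isAddHaarMeasure volume (Measure.hausdorffMeasure n) ?_
  refine le_antisymm ((hT.hausdorffMeasure_image_le (by positivity) S).trans ?_) zero_le
  rw [h1, mul_zero]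

namespace ConvexBody

variable {n s : ℕ} {lam : Fin s → ℝ} {K : Fin s → ConvexBody (Euc n)}

lemma inner_fderiv_metricProj_nonneg (K : ConvexBody (Euc n)) (x v : Euc n) :
    0 ≤ ⟪fderiv ℝ K.metricProj x v, v⟫ := by
  by_cases hd : DifferentiableAt ℝ K.metricProj x
  · have h1 : HasDerivAt (fun t : ℝ => x + t • v) v 0 := by
      simpa using ((hasDerivAt_id (0 : ℝ)).smul_const v).const_add x
    have h2 : HasFDerivAt K.metricProj (fderiv ℝ K.metricProj x) (x + (0 : ℝ) • v) := by
      simpa using hd.hasFDerivAt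
    have h3 := (h2.comp_hasDerivAt (0 : ℝ) h1).inner ℝ (hasDerivAt_const (0 : ℝ) v)
    simp only [inner_zero_right, zero_add] at h3
    have hmono : Monotone fun t : ℝ => (⟪(K.metricProj ∘ fun t : ℝ => x + t • v) t, v⟫ : ℝ) := by
      intro a b hab
      rcases hab.eq_or_lt with rfl | hab
      · rfl
      have := K.inner_metricProj_sub_nonneg (x + b • v) (x + a • v)
      rw [add_sub_add_left_eq_sub, ← sub_smul, real_inner_smul_right, inner_sub_left] at this
      have := nonneg_of_mul_nonneg_right this (sub_pos.2 hab)
      simp only [Function.comp_apply]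
      linarith
    rw [← h3.deriv]
    exact hmono.deriv_nonneg
  · simp [fderiv_zero_of_not_differentiableAt hd]

/-- The Jacobian determinant of `projComb lam K`. -/
def projJac (lam : Fin s → ℝ) (K : Fin s → ConvexBody (Euc n)) (x : Euc n) : ℝ :=
  (∑ i, lam i • fderiv ℝ (K i).metricProj x).det

lemma projJac_nonneg (hlam : ∀ i, 0 ≤ lam i) (x : Euc n) : 0 ≤ projJac lam K x := by
  refine ContinuousLinearMap.det_nonneg_of_inner_nonneg _ fun v => ?_
  simp only [_root_.sum_apply, _root_.smul_apply, sum_inner,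
    real_inner_smul_left]
  exact Finset.sum_nonneg fun i _ =>
    mul_nonneg (hlam i) ((K i).inner_fderiv_metricProj_nonneg x v)

/-- The points at which all metric projections onto a family of bodies are differentiable. -/
def diffSet (K : Fin s → ConvexBody (Euc n)) : Set (Euc n) :=
  {x | ∀ i, DifferentiableAt ℝ (K i).metricProj x}

lemma measurableSet_diffSet (K : Fin s → ConvexBody (Euc n)) : MeasurableSet (diffSet K) := by
  rw [diffSet, ofPred_forall]
  exact MeasurableSet.iInter fun i => measurableSet_of_differentiableAt ℝ _

lemma volume_compl_diffSet (K : Fin s → ConvexBody (Euc n)) : volume (diffSet K)ᶜ = 0 := by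
  have h : ∀ᵐ x : Euc n, ∀ i, DifferentiableAt ℝ (K i).metricProj x :=
    ae_all_iff.2 fun i => (K i).lipschitzWith_metricProj.ae_differentiableAt
  exact h

lemma measurable_projJac (lam : Fin s → ℝ) (K : Fin s → ConvexBody (Euc n)) :
    Measurable (projJac lam K) := by
  refine ContinuousLinearMap.continuous_det.measurable.comp ?_
  exact Finset.measurable_sum _ fun i _ => (measurable_fderiv ℝ _).const_smul (lam i)

lemma hasFDerivAt_projComb {x : Euc n} (hx : x ∈ diffSet K) :
    HasFDerivAt (projComb lam K) (∑ i, lam i • fderiv ℝ (K i).metricProj x) x :=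
  HasFDerivAt.fun_sum fun i _ => (hx i).hasFDerivAt.const_smul (lam i)

/-- The points at which `projComb lam K` has nonzero Jacobian. -/
def regularSet (lam : Fin s → ℝ) (K : Fin s → ConvexBody (Euc n)) : Set (Euc n) :=
  diffSet K ∩ {x | projJac lam K x ≠ 0}

lemma measurableSet_regularSet (lam : Fin s → ℝ) (K : Fin s → ConvexBody (Euc n)) :
    MeasurableSet (regularSet lam K) :=
  (measurableSet_diffSet K).inter
    (measurable_projJac lam K (measurableSet_singleton (0 : ℝ)).compl)

lemma injOn_projComb (hlam : ∀ i, 0 ≤ lam i) : InjOn (projComb lam K) (regularSet lam K) := by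
  intro x hx y _ h
  have h1 : HasDerivWithinAt (fun t : ℝ => projComb lam K (x + t • (y - x)))
      ((∑ i, lam i • fderiv ℝ (K i).metricProj x) (y - x)) (Icc 0 1) 0 := by
    have hl : HasDerivAt (fun t : ℝ => x + t • (y - x)) (y - x) 0 := by
      simpa using ((hasDerivAt_id (0 : ℝ)).smul_const (y - x)).const_add x
    have hf : HasFDerivAt (projComb lam K) (∑ i, lam i • fderiv ℝ (K i).metricProj x)
        (x + (0 : ℝ) • (y - x)) := by
      simpa using hasFDerivAt_projComb hx.1
    exact (hf.comp_hasDerivAt (0 : ℝ) hl).hasDerivWithinAt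
  have h2 : HasDerivWithinAt (fun t : ℝ => projComb lam K (x + t • (y - x))) 0 (Icc 0 1) 0 :=
    (hasDerivWithinAt_const (0 : ℝ) (Icc 0 1) (projComb lam K x)).congr
      (fun t ht => projComb_add_smul_sub hlam h ht)
      (projComb_add_smul_sub hlam h ⟨le_rfl, zero_le_one⟩)
  have h3 := (uniqueDiffOn_Icc_zero_one 0 ⟨le_rfl, zero_le_one⟩).eq_deriv _ h1 h2
  by_contra hne
  refine hx.2 ?_
  by_contra hdet
  have hker := LinearMap.ker_eq_bot'.1 (LinearMap.ker_eq_bot.2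
    (LinearEquiv.ofIsUnitDet (f := ((∑ i, lam i • fderiv ℝ (K i).metricProj x : Euc n →L[ℝ] Euc n) :
      Euc n →ₗ[ℝ] Euc n)) (v := (EuclideanSpace.basisFun (Fin n) ℝ).toBasis)
      (v' := (EuclideanSpace.basisFun (Fin n) ℝ).toBasis)
      (by rw [LinearMap.det_toMatrix]; exact isUnit_iff_ne_zero.2 hdet)).injective)
  exact hne (sub_eq_zero.1 (hker (y - x) h3)).symm

lemma image_regularSet_ae_eq (hlam : ∀ i, 0 ≤ lam i) :
    (projComb lam K '' regularSet lam K : Set (Euc n)) =ᵐ[volume]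
      (∑ i, lam i • (K i : Set (Euc n)) : Set (Euc n)) := by
  set E : Set (Euc n) := ∑ i, lam i • (K i : Set (Euc n)) with hE
  refine LE.le.eventuallyLE (image_subset_iff.2 fun x _ => projComb_mem lam K x)
    |>.antisymm ?_
  rw [ae_le_set]
  have hcrit : volume (projComb lam K '' (diffSet K ∩ {x | projJac lam K x = 0})) = 0 :=
    addHaar_image_eq_zero_of_det_fderivWithin_eq_zero volume
      (fun x hx => (hasFDerivAt_projComb hx.1).hasFDerivWithinAt) fun x hx => hx.2
  obtain ⟨C, hC⟩ := exists_lipschitzWith_projComb lam K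
  have hnd := hC.volume_image_eq_zero (volume_compl_diffSet K)
  have hfr : volume (frontier E) = 0 := (convex_sum_smul lam K).addHaar_frontier volume
  refine measure_mono_null ?_ (measure_union_null hfr (measure_union_null hcrit hnd))
  rintro y ⟨hy, hy'⟩
  by_cases hyi : y ∈ interior E
  · obtain ⟨ε, hε, hdeep⟩ := exists_isDeep_of_mem_interior hyi
    obtain ⟨x, rfl⟩ := hdeep.exists_projComb_eq hlam hε
    right
    by_cases hx : x ∈ diffSet K
    · left
      refine ⟨x, ⟨hx, ?_⟩, rfl⟩
      by_contra hne
      exact hy' ⟨x, ⟨hx, hne⟩, rfl⟩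
    · exact Or.inr ⟨x, hx, rfl⟩
  · exact Or.inl ⟨subset_closure hy, hyi⟩

variable {F : Type*} [NormedAddCommGroup F] [NormedSpace ℝ F]

lemma indicator_regularSet_ae_eq (hlam : ∀ i, 0 ≤ lam i) (h : Euc n → F) :
    (regularSet lam K).indicator (fun x =>
        |(∑ i, lam i • fderiv ℝ (K i).metricProj x).det| • h (projComb lam K x)) =ᵐ[volume]
      fun x => projJac lam K x • h (projComb lam K x) := by
  have hd : ∀ᵐ x : Euc n, x ∈ diffSet K := volume_compl_diffSet K
  filter_upwards [hd] with x hx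
  by_cases hx0 : projJac lam K x = 0
  · rw [indicator_of_notMem (fun hx' => hx'.2 hx0), hx0, zero_smul]
  · rw [indicator_of_mem (show x ∈ regularSet lam K from ⟨hx, hx0⟩)]
    congr 1
    exact abs_of_nonneg (projJac_nonneg hlam x)

lemma integral_sum_smul_eq (hlam : ∀ i, 0 ≤ lam i) (h : Euc n → F) :
    ∫ y in (∑ i, lam i • (K i : Set (Euc n))), h y =
      ∫ x, projJac lam K x • h (projComb lam K x) := by
  rw [← setIntegral_congr_set (image_regularSet_ae_eq hlam),
    integral_image_eq_integral_abs_det_fderiv_smul volume (measurableSet_regularSet lam K)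
      (fun x hx => (hasFDerivAt_projComb hx.1).hasFDerivWithinAt) (injOn_projComb hlam),
    ← integral_indicator (measurableSet_regularSet lam K)]
  exact integral_congr_ae (indicator_regularSet_ae_eq hlam h)

lemma integrableOn_sum_smul_iff (hlam : ∀ i, 0 ≤ lam i) (h : Euc n → F) :
    IntegrableOn h (∑ i, lam i • (K i : Set (Euc n))) ↔
      Integrable fun x => projJac lam K x • h (projComb lam K x) := by
  rw [← integrableOn_congr_set_ae (image_regularSet_ae_eq hlam),
    integrableOn_image_iff_integrableOn_abs_det_fderiv_smul volume
      (measurableSet_regularSet lam K)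
      (fun x hx => (hasFDerivAt_projComb hx.1).hasFDerivWithinAt) (injOn_projComb hlam),
    ← integrable_indicator_iff (measurableSet_regularSet lam K)]
  exact integrable_congr (indicator_regularSet_ae_eq hlam h)

end ConvexBody

namespace ConvexBody

variable {n s : ℕ} {lam : Fin s → ℝ} {K : Fin s → ConvexBody (Euc n)}

open Classical in
/-- The decomposition of a point of a Minkowski combination of convex bodies induced by the metric
projections; it is `0` at points which are not in the range of `projComb lam K`. -/
def decomp (lam : Fin s → ℝ) (K : Fin s → ConvexBody (Euc n)) (y : Euc n) : Fin s → Euc n :=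
  if h : ∃ x, projComb lam K x = y then fun i => (K i).metricProj h.choose else 0

lemma decomp_projComb (hlam : ∀ i, 0 < lam i) (x : Euc n) :
    decomp lam K (projComb lam K x) = fun i => (K i).metricProj x := by
  have h : ∃ x', projComb lam K x' = projComb lam K x := ⟨x, rfl⟩
  rw [decomp, dif_pos h]
  funext i
  exact metricProj_eq_of_projComb_eq (fun i => (hlam i).le) h.choose_spec (hlam i).ne'

lemma norm_decomp_le {R : ℝ} (hR0 : 0 ≤ R) (hR : BoundedBy K R) (y : Euc n) :
    ‖decomp lam K y‖ ≤ R := by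
  rw [decomp]
  split_ifs with h
  · exact (pi_norm_le_iff_of_nonneg hR0).2 fun i => hR i _ ((K i).metricProj_mem _)
  · simpa using hR0

lemma IsDeep.of_dist_le (hlam : ∀ i, 0 ≤ lam i) {L : Fin s → ConvexBody (Euc n)} {ε : ℝ}
    {y z : Euc n} (h : IsDeep lam K ε y)
    (hd : ∑ i, lam i * dist (K i) (L i) + dist y z ≤ ε / 2) : IsDeep lam L (ε / 2) z := by
  intro x
  obtain ⟨k, hk, hx⟩ := h x
  choose l hl hkl using fun i => (K i).exists_dist_le_dist (L i) (hk i)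
  refine ⟨l, hl, ?_⟩
  have h1 : ‖(∑ i, lam i • k i - y) - (∑ i, lam i • l i - z)‖ ≤ ε / 2 := by
    refine le_trans ?_ hd
    rw [sub_sub_sub_comm, ← Finset.sum_sub_distrib, dist_eq_norm]
    refine (norm_sub_le _ _).trans (add_le_add_left ?_ _)
    refine (norm_sum_le _ _).trans (Finset.sum_le_sum fun i _ => ?_)
    rw [← smul_sub, norm_smul, Real.norm_of_nonneg (hlam i), ← dist_eq_norm]
    exact mul_le_mul_of_nonneg_left (hkl i) (hlam i)
  have h2 := (real_inner_le_norm x _).trans (mul_le_mul_of_nonneg_left h1 (norm_nonneg x))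
  rw [inner_sub_right] at h2
  linarith

lemma BoundedBy.of_dist_le {L : Fin s → ConvexBody (Euc n)} {R : ℝ} (hR : BoundedBy K R)
    (hd : ∀ i, dist (L i) (K i) ≤ 1) : BoundedBy L (R + 1) := by
  intro i x hx
  obtain ⟨p, hp, h⟩ := (L i).exists_dist_le_dist (K i) hx
  have h1 := hR i p hp
  have h2 := norm_le_norm_add_norm_sub' x p
  rw [← dist_eq_norm] at h2
  linarith [hd i]

lemma infDist_sum_smul_le (hlam : ∀ i, 0 ≤ lam i) {L : Fin s → ConvexBody (Euc n)} {y : Euc n}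
    (hy : y ∈ (∑ i, lam i • (L i : Set (Euc n)))) :
    Metric.infDist y (∑ i, lam i • (K i : Set (Euc n))) ≤ ∑ i, lam i * dist (L i) (K i) := by
  obtain ⟨l, hl, rfl⟩ := mem_sum_smul_iff.1 hy
  choose k hk hkl using fun i => (L i).exists_dist_le_dist (K i) (hl i)
  refine (Metric.infDist_le_dist_of_mem (mem_sum_smul_iff.2 ⟨k, hk, rfl⟩)).trans ?_
  rw [dist_eq_norm, ← Finset.sum_sub_distrib]
  refine (norm_sum_le _ _).trans (Finset.sum_le_sum fun i _ => ?_)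
  rw [← smul_sub, norm_smul, Real.norm_of_nonneg (hlam i), ← dist_eq_norm]
  exact mul_le_mul_of_nonneg_left (hkl i) (hlam i)

section Limits

variable {ι : Type*} {l : Filter ι} {Kl : ι → Fin s → ConvexBody (Euc n)}

lemma tendsto_sum_mul_dist (lam : Fin s → ℝ) (hK : ∀ i, Tendsto (fun a => Kl a i) l (𝓝 (K i))) :
    Tendsto (fun a => ∑ i, lam i * dist (Kl a i) (K i)) l (𝓝 0) := by
  have h : Tendsto (fun a => ∑ i, lam i * dist (Kl a i) (K i)) l (𝓝 (∑ i, lam i * 0)) :=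
    tendsto_finsetSum _ fun i _ => (tendsto_iff_dist_tendsto_zero.1 (hK i)).const_mul (lam i)
  simpa using h

lemma eventually_boundedBy (hK : ∀ i, Tendsto (fun a => Kl a i) l (𝓝 (K i))) {R : ℝ}
    (hR : BoundedBy K R) : ∀ᶠ a in l, BoundedBy (Kl a) (R + 1) := by
  have h : ∀ᶠ a in l, ∀ i, dist (Kl a i) (K i) < 1 :=
    eventually_all.2 fun i => (tendsto_iff_dist_tendsto_zero.1 (hK i)).eventually_lt_const one_pos
  exact h.mono fun a ha => hR.of_dist_le fun i => (ha i).le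

lemma eventually_notMem_sum_smul (hlam : ∀ i, 0 ≤ lam i)
    (hK : ∀ i, Tendsto (fun a => Kl a i) l (𝓝 (K i))) {y : Euc n}
    (hy : y ∉ (∑ i, lam i • (K i : Set (Euc n)))) :
    ∀ᶠ a in l, y ∉ (∑ i, lam i • (Kl a i : Set (Euc n))) := by
  have hne : (∑ i, lam i • (K i : Set (Euc n)) : Set (Euc n)).Nonempty :=
    ⟨_, projComb_mem lam K 0⟩
  have hpos := ((isCompact_sum_smul lam K).isClosed.notMem_iff_infDist_pos hne).1 hy
  filter_upwards [(tendsto_sum_mul_dist lam hK).eventually_lt_const hpos] with a ha hya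
  exact ha.not_ge (infDist_sum_smul_le hlam hya)

lemma eventually_isDeep (hlam : ∀ i, 0 ≤ lam i)
    (hK : ∀ i, Tendsto (fun a => Kl a i) l (𝓝 (K i))) {yl : ι → Euc n} {y : Euc n}
    (hy : Tendsto yl l (𝓝 y)) {ε : ℝ} (hε : 0 < ε) (h : IsDeep lam K ε y) :
    ∀ᶠ a in l, IsDeep lam (Kl a) (ε / 2) (yl a) := by
  have h1 := (tendsto_sum_mul_dist lam hK).add (tendsto_iff_dist_tendsto_zero.1 hy)
  rw [add_zero] at h1
  filter_upwards [h1.eventually_lt_const (half_pos hε)] with a ha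
  refine h.of_dist_le hlam ?_
  simp only [dist_comm] at ha ⊢
  exact ha.le

lemma tendsto_decomp (hlam : ∀ i, 0 < lam i) (hK : ∀ i, Tendsto (fun a => Kl a i) l (𝓝 (K i)))
    {yl : ι → Euc n} {y : Euc n} (hy : Tendsto yl l (𝓝 y))
    (hyi : y ∈ interior (∑ i, lam i • (K i : Set (Euc n)))) :
    Tendsto (fun a => decomp lam (Kl a) (yl a)) l (𝓝 (decomp lam K y)) := by
  have hlam' := fun i => (hlam i).le
  obtain ⟨ε, hε, hdeep⟩ := exists_isDeep_of_mem_interior hyi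
  obtain ⟨x, rfl⟩ := hdeep.exists_projComb_eq hlam' hε
  obtain ⟨R, hR0, hR⟩ := exists_boundedBy K
  set B : ℝ := (∑ i, lam i) * (2 * (R + 1) ^ 2) / (ε / 2) with hB
  set e : ι → Fin s → ℝ := fun a i => √(2 * (B + (R + 1)) * dist (Kl a i) (K i)) with he
  set q : ι → Fin s → ℝ := fun a i =>
    (lam i)⁻¹ * ((‖x‖ + B) * (dist (yl a) (projComb lam K x) + ∑ i, lam i * e a i)) with hq
  have he0 : ∀ i, Tendsto (fun a => e a i) l (𝓝 0) := by
    intro i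
    have h := ((tendsto_iff_dist_tendsto_zero.1 (hK i)).const_mul (2 * (B + (R + 1)))).sqrt
    rwa [mul_zero, Real.sqrt_zero] at h
  have hq0 : ∀ i, Tendsto (fun a => q a i) l (𝓝 0) := by
    intro i
    have h1 : Tendsto (fun a => ∑ i, lam i * e a i) l (𝓝 (∑ i, lam i * 0)) :=
      tendsto_finsetSum _ fun i _ => (he0 i).const_mul (lam i)
    have h := (((tendsto_iff_dist_tendsto_zero.1 hy).add h1).const_mul (‖x‖ + B)).const_mul
      (lam i)⁻¹
    simpa using h
  rw [decomp_projComb hlam, tendsto_pi_nhds]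
  intro i
  rw [tendsto_iff_norm_sub_tendsto_zero]
  have hlim : Tendsto (fun a => e a i + √(q a i)) l (𝓝 0) := by
    simpa using (he0 i).add (hq0 i).sqrt
  refine squeeze_zero' (Eventually.of_forall fun a => norm_nonneg _) ?_ hlim
  filter_upwards [eventually_isDeep hlam' hK hy hε hdeep, eventually_boundedBy hK hR]
    with a hda hRa
  obtain ⟨z, hz⟩ := hda.exists_projComb_eq hlam' (half_pos hε)
  rw [← hz, decomp_projComb hlam]
  have hzB : ‖z‖ ≤ B := by
    rw [hB, le_div_iff₀ (half_pos hε), mul_comm]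
    exact IsDeep.mul_norm_le hlam' hRa (hz ▸ hda)
  have hei : ∀ i, ‖(Kl a i).metricProj z - (K i).metricProj z‖ ≤ e a i := by
    intro i
    refine Real.le_sqrt_of_sq_le ?_
    refine ((Kl a i).sq_norm_metricProj_sub_metricProj_le (K i) z).trans ?_
    refine mul_le_mul_of_nonneg_right ?_ dist_nonneg
    have h1 := norm_sub_le z ((Kl a i).metricProj z)
    have h2 := norm_sub_le z ((K i).metricProj z)
    have h3 := hRa i _ ((Kl a i).metricProj_mem z)
    have h4 := hR i _ ((K i).metricProj_mem z)
    linarith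
  have hsum : ∑ i, lam i * ‖(K i).metricProj x - (K i).metricProj z‖ ^ 2 ≤
      (‖x‖ + B) * (dist (yl a) (projComb lam K x) + ∑ i, lam i * e a i) := by
    refine (sum_mul_sq_norm_metricProj_sub_le hlam' x z).trans ?_
    refine (real_inner_le_norm _ _).trans ?_
    rw [mul_comm]
    refine mul_le_mul ((norm_sub_le _ _).trans (by gcongr)) ?_ (norm_nonneg _)
      (add_nonneg (norm_nonneg _) ((norm_nonneg _).trans hzB))
    rw [← hz, dist_comm, dist_eq_norm]
    refine (norm_sub_le_norm_sub_add_norm_sub _ (projComb lam (Kl a) z) _).trans ?_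
    refine add_le_add_right ?_ _
    rw [projComb, projComb, ← Finset.sum_sub_distrib]
    refine (norm_sum_le _ _).trans (Finset.sum_le_sum fun i _ => ?_)
    rw [← smul_sub, norm_smul, Real.norm_of_nonneg (hlam' i)]
    exact mul_le_mul_of_nonneg_left (hei i) (hlam' i)
  have hqi : ‖(K i).metricProj x - (K i).metricProj z‖ ≤ √(q a i) := by
    refine Real.le_sqrt_of_sq_le ?_
    rw [hq, le_inv_mul_iff₀ (hlam i)]
    exact (Finset.single_le_sum (f := fun i =>
      lam i * ‖(K i).metricProj x - (K i).metricProj z‖ ^ 2)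
      (fun i _ => mul_nonneg (hlam' i) (sq_nonneg _)) (Finset.mem_univ i)).trans hsum
  rw [norm_sub_rev] at hqi
  exact (norm_sub_le_norm_sub_add_norm_sub _ ((K i).metricProj z) _).trans
    (add_le_add (hei i) hqi)

end Limits

lemma continuousOn_decomp (hlam : ∀ i, 0 < lam i) (K : Fin s → ConvexBody (Euc n)) :
    ContinuousOn (decomp lam K) (interior (∑ i, lam i • (K i : Set (Euc n)))) := by
  intro y hy
  have h := tendsto_decomp (l := 𝓝 y) (Kl := fun _ => K) (yl := fun z => z) hlam
    (fun _ => tendsto_const_nhds) tendsto_id hy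
  exact h.mono_left nhdsWithin_le_nhds

lemma aestronglyMeasurable_decomp (hlam : ∀ i, 0 < lam i) (K : Fin s → ConvexBody (Euc n)) :
    AEStronglyMeasurable (decomp lam K)
      (volume.restrict (∑ i, lam i • (K i : Set (Euc n)) : Set (Euc n))) := by
  rw [← Measure.restrict_congr_set (interior_ae_eq_of_null_frontier
    ((convex_sum_smul lam K).addHaar_frontier volume))]
  exact (continuousOn_decomp hlam K).aestronglyMeasurable isOpen_interior.measurableSet

end ConvexBody

namespace ConvexBody

variable {n s : ℕ}

/-- The interpolation nodes `1, …, n + 1` in each coordinate. -/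
def gridNode (g : Fin s → Fin (n + 1)) (i : Fin s) : ℝ := (g i : ℝ) + 1

lemma gridNode_pos (g : Fin s → Fin (n + 1)) (i : Fin s) : 0 < gridNode g i := by
  unfold gridNode
  positivity

/-- The tensor product Lagrange basis for the grid `{1, …, n + 1} ^ s`. -/
def gridBasis (g : Fin s → Fin (n + 1)) (lam : Fin s → ℝ) : ℝ :=
  ∏ i, (Lagrange.basis Finset.univ (fun k : Fin (n + 1) => (k : ℝ) + 1) (g i)).eval (lam i)

lemma contDiff_gridBasis (g : Fin s → Fin (n + 1)) {r : WithTop ℕ∞} :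
    ContDiff ℝ r (gridBasis g) := by
  refine contDiff_prod fun i _ => ?_
  have h := (Lagrange.basis Finset.univ (fun k : Fin (n + 1) => (k : ℝ) + 1) (g i)).contDiff_aeval
    (𝕜 := ℝ) (n := r)
  simp only [Polynomial.coe_aeval_eq_eval] at h
  exact h.comp (contDiff_apply ℝ ℝ i)

lemma pow_eq_sum_basis {a : ℕ} (ha : a ≤ n) (t : ℝ) :
    t ^ a = ∑ k : Fin (n + 1),
      (Lagrange.basis Finset.univ (fun k : Fin (n + 1) => (k : ℝ) + 1) k).eval t *
        ((k : ℝ) + 1) ^ a := by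
  have h := Lagrange.eq_interpolate (s := Finset.univ) (v := fun k : Fin (n + 1) => (k : ℝ) + 1)
    (f := (Polynomial.X : Polynomial ℝ) ^ a) (fun k _ l _ hkl => by simpa [Fin.ext_iff] using hkl)
    (by rw [Polynomial.degree_X_pow, Finset.card_univ, Fintype.card_fin]; exact_mod_cast by omega)
  have h2 := congrArg (Polynomial.eval t) h
  rw [Lagrange.interpolate_apply, Polynomial.eval_finsetSum] at h2
  simpa [mul_comm] using h2

lemma prod_comp_eq_sum_gridBasis (c : Fin n → Fin s) (lam : Fin s → ℝ) :
    ∏ j, lam (c j) = ∑ g : Fin s → Fin (n + 1), gridBasis g lam * ∏ j, gridNode g (c j) := by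
  have key : ∀ μ : Fin s → ℝ, ∏ j, μ (c j) = ∏ i, μ i ^ (Finset.univ.filter (c · = i)).card := by
    intro μ
    rw [← Finset.prod_fiberwise Finset.univ c]
    refine Finset.prod_congr rfl fun i _ => ?_
    rw [← Finset.prod_const]
    exact Finset.prod_congr rfl fun j hj => by rw [(Finset.mem_filter.1 hj).2]
  have hle : ∀ i, (Finset.univ.filter (c · = i)).card ≤ n := fun i =>
    (Finset.card_filter_le _ _).trans (by simp)
  simp only [key]
  simp only [gridBasis, gridNode, ← Finset.prod_mul_distrib]
  rw [Finset.prod_congr rfl fun i _ => pow_eq_sum_basis (hle i) (lam i), Fintype.prod_sum]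

lemma det_sum_smul_eq_sum_gridBasis (A : Fin s → Euc n →L[ℝ] Euc n) (lam : Fin s → ℝ) :
    (∑ i, lam i • A i).det =
      ∑ g : Fin s → Fin (n + 1), gridBasis g lam * (∑ i, gridNode g i • A i).det := by
  set b := (EuclideanSpace.basisFun (Fin n) ℝ).toBasis
  set M : Fin s → Matrix (Fin n) (Fin n) ℝ := fun i =>
    LinearMap.toMatrix b b (A i : Euc n →ₗ[ℝ] Euc n) with hM
  have key : ∀ μ : Fin s → ℝ, (∑ i, μ i • A i).det =
      ∑ c : Fin n → Fin s, (∏ j, μ (c j)) * Matrix.det fun j => M (c j) j := by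
    intro μ
    have h1 : (∑ i, μ i • A i).det = Matrix.det fun j => ∑ i, μ i • M i j := by
      change LinearMap.det ((∑ i, μ i • A i : Euc n →L[ℝ] Euc n) : Euc n →ₗ[ℝ] Euc n) = _
      rw [← LinearMap.det_toMatrix b]
      congr 1
      ext j k
      simp [hM, Finset.sum_apply, LinearMap.toMatrix_apply]
    rw [h1]
    have h2 := (Matrix.detRowAlternating (n := Fin n) (R := ℝ)).toMultilinearMap.map_sum
      (fun j i => μ i • M i j)
    refine h2.trans (Finset.sum_congr rfl fun c _ => ?_)
    exact (Matrix.detRowAlternating (n := Fin n) (R := ℝ)).toMultilinearMap.map_smul_univ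
      (fun j => μ (c j)) (fun j => M (c j) j)
  rw [key]
  simp only [key, prod_comp_eq_sum_gridBasis _ lam, Finset.sum_mul, Finset.mul_sum, mul_assoc]
  exact Finset.sum_comm

lemma projJac_eq_sum_gridBasis (lam : Fin s → ℝ) (K : Fin s → ConvexBody (Euc n)) (x : Euc n) :
    projJac lam K x =
      ∑ g : Fin s → Fin (n + 1), gridBasis g lam * projJac (gridNode g) K x :=
  det_sum_smul_eq_sum_gridBasis _ lam

variable {F : Type*} [NormedAddCommGroup F] [NormedSpace ℝ F]

lemma integral_sum_smul_eq_sum_gridBasis {lam : Fin s → ℝ} (hlam : ∀ i, 0 ≤ lam i)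
    (K : Fin s → ConvexBody (Euc n)) {f : Euc n → F} (hf : Continuous f) :
    ∫ x in (∑ i, lam i • (K i : Set (Euc n))), f x =
      ∑ g : Fin s → Fin (n + 1), gridBasis g lam •
        ∫ y in (∑ i, gridNode g i • (K i : Set (Euc n))),
          f (∑ i, lam i • decomp (gridNode g) K y i) := by
  obtain ⟨R, hR0, hR⟩ := exists_boundedBy K
  have hc : Continuous fun k : Fin s → Euc n => f (∑ i, lam i • k i) := by fun_prop
  obtain ⟨C, hC⟩ := (isCompact_closedBall (0 : Fin s → Euc n) R).exists_bound_of_continuousOn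
    hc.continuousOn
  have hint : ∀ g : Fin s → Fin (n + 1), IntegrableOn
      (fun y => f (∑ i, lam i • decomp (gridNode g) K y i))
      (∑ i, gridNode g i • (K i : Set (Euc n)) : Set (Euc n)) := by
    intro g
    refine IntegrableOn.of_bound (isCompact_sum_smul _ K).measure_lt_top
      (hc.comp_aestronglyMeasurable (aestronglyMeasurable_decomp (gridNode_pos g) K)) C
      (Eventually.of_forall fun y => hC _ ?_)
    simpa using norm_decomp_le hR0.le hR y
  have hval : ∀ (g : Fin s → Fin (n + 1)) (x : Euc n),
      ∑ i, lam i • decomp (gridNode g) K (projComb (gridNode g) K x) i = projComb lam K x := by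
    intro g x
    rw [decomp_projComb (gridNode_pos g)]
    rfl
  have hpos : ∀ (g : Fin s → Fin (n + 1)) i, 0 ≤ gridNode g i := fun g i => (gridNode_pos g i).le
  have hint' := fun g => (integrableOn_sum_smul_iff (hpos g) _).1 (hint g)
  simp only [integral_sum_smul_eq hlam, integral_sum_smul_eq (hpos _), hval] at hint' ⊢
  simp only [projJac_eq_sum_gridBasis lam K, Finset.sum_smul, mul_smul]
  rw [integral_finsetSum]
  · simp only [integral_smul]
  · exact fun g _ => (hint' g).smul (gridBasis g lam)

end ConvexBody

section Comb

variable {s : ℕ} {V F : Type*} [NormedAddCommGroup V] [NormedSpace ℝ V] [NormedAddCommGroup F]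
  [NormedSpace ℝ F]

/-- The linear map sending coefficients to the corresponding linear combination of `k`. -/
def combCLM (k : Fin s → V) : (Fin s → ℝ) →L[ℝ] V :=
  ∑ i, (ContinuousLinearMap.proj i : (Fin s → ℝ) →L[ℝ] ℝ).smulRight (k i)

lemma combCLM_apply (k : Fin s → V) (lam : Fin s → ℝ) : combCLM k lam = ∑ i, lam i • k i := by
  simp [combCLM]

lemma continuous_combCLM : Continuous (combCLM : (Fin s → V) → (Fin s → ℝ) →L[ℝ] V) := by
  unfold combCLM
  exact continuous_finsetSum _ fun i _ =>
    ((ContinuousLinearMap.smulRightL ℝ (Fin s → ℝ) V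
      (ContinuousLinearMap.proj i : (Fin s → ℝ) →L[ℝ] ℝ)).continuous).comp (continuous_apply i)

lemma tendsto_combCLM_apply {ι : Type*} {l : Filter ι} {k : ι → Fin s → V} {k₀ : Fin s → V}
    {x : ι → Fin s → ℝ} {x₀ : Fin s → ℝ} (hk : Tendsto k l (𝓝 k₀)) (hx : Tendsto x l (𝓝 x₀)) :
    Tendsto (fun a => combCLM (k a) (x a)) l (𝓝 (combCLM k₀ x₀)) := by
  simp only [combCLM_apply]
  exact tendsto_finsetSum _ fun i _ =>
    (tendsto_pi_nhds.1 hx i).smul (tendsto_pi_nhds.1 hk i)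

lemma norm_combCLM_le (k : Fin s → V) : ‖combCLM k‖ ≤ s * ‖k‖ := by
  refine ContinuousLinearMap.opNorm_le_bound _ (by positivity) fun lam => ?_
  rw [combCLM_apply]
  refine (norm_sum_le_of_le Finset.univ fun i _ => (norm_smul_le (lam i) (k i)).trans
    (mul_le_mul (norm_le_pi_norm lam i) (norm_le_pi_norm k i) (norm_nonneg _)
      (norm_nonneg _))).trans_eq ?_
  simp only [Finset.sum_const, Finset.card_univ, Fintype.card_fin, nsmul_eq_mul]
  ring

lemma norm_combCLM_apply_le {k : Fin s → V} {lam : Fin s → ℝ} {R ρ : ℝ} (hk : ‖k‖ ≤ R)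
    (hlam : ‖lam‖ ≤ ρ) : ‖combCLM k lam‖ ≤ s * R * ρ :=
  ((combCLM k).le_opNorm lam).trans (mul_le_mul ((norm_combCLM_le k).trans (by gcongr)) hlam
    (norm_nonneg _) (mul_nonneg (Nat.cast_nonneg _) ((norm_nonneg _).trans hk)))

/-- The `j`-th derivative of `lam ↦ f (∑ i, lam i • k i)`. -/
def combDeriv (f : V → F) (j : ℕ) (lam : Fin s → ℝ) (k : Fin s → V) : (Fin s → ℝ) [×j]→L[ℝ] F :=
  (iteratedFDeriv ℝ j f (combCLM k lam)).compContinuousLinearMap fun _ => combCLM k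

lemma norm_combDeriv_le (f : V → F) (j : ℕ) (lam : Fin s → ℝ) (k : Fin s → V) :
    ‖combDeriv f j lam k‖ ≤ ‖iteratedFDeriv ℝ j f (combCLM k lam)‖ * (s * ‖k‖) ^ j := by
  refine (ContinuousMultilinearMap.norm_compContinuousLinearMap_le _ _).trans ?_
  rw [Finset.prod_const, Finset.card_univ, Fintype.card_fin]
  gcongr
  exact norm_combCLM_le k

lemma tendsto_compContinuousLinearMap_combCLM {ι : Type*} {l : Filter ι} {j : ℕ}
    {T : ι → V [×j]→L[ℝ] F} {T₀ : V [×j]→L[ℝ] F} {k : ι → Fin s → V} {k₀ : Fin s → V}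
    (hT : Tendsto T l (𝓝 T₀)) (hk : Tendsto k l (𝓝 k₀)) :
    Tendsto (fun a => (T a).compContinuousLinearMap fun _ => combCLM (k a)) l
      (𝓝 (T₀.compContinuousLinearMap fun _ => combCLM k₀)) := by
  have h1 : Tendsto (fun a (_ : Fin j) => combCLM (k a)) l (𝓝 fun _ => combCLM k₀) :=
    tendsto_pi_nhds.2 fun _ => (continuous_combCLM.tendsto _).comp hk
  have h2 := ((ContinuousMultilinearMap.compContinuousLinearMapContinuousMultilinear ℝ
    (fun _ : Fin j => Fin s → ℝ) (fun _ : Fin j => V) F).cont.tendsto _).comp h1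
  exact ((continuous_fst.clm_apply continuous_snd).tendsto (_, T₀)).comp (h2.prodMk_nhds hT)

variable {r : WithTop ℕ∞} {f : V → F} {j : ℕ}

lemma continuous_combDeriv (hf : ContDiff ℝ r f) (hj : j ≤ r) :
    Continuous fun p : (Fin s → ℝ) × (Fin s → V) => combDeriv f j p.1 p.2 := by
  refine continuous_iff_continuousAt.2 fun p => ?_
  refine tendsto_compContinuousLinearMap_combCLM (T₀ := iteratedFDeriv ℝ j f (combCLM p.2 p.1)) ?_
    (continuous_snd.tendsto p)
  exact ((hf.continuous_iteratedFDeriv hj).tendsto _).comp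
    (tendsto_combCLM_apply (continuous_snd.tendsto p) (continuous_fst.tendsto p))

lemma exists_norm_combDeriv_le [FiniteDimensional ℝ V] (hf : ContDiff ℝ r f) (hj : j ≤ r)
    (ρ R : ℝ) : ∃ C, ∀ lam : Fin s → ℝ, ‖lam‖ ≤ ρ → ∀ k : Fin s → V, ‖k‖ ≤ R →
      ‖combDeriv f j lam k‖ ≤ C := by
  have := FiniteDimensional.proper ℝ V
  obtain ⟨C, hC⟩ := ((isCompact_closedBall (0 : Fin s → ℝ) ρ).prod
    (isCompact_closedBall (0 : Fin s → V) R)).exists_bound_of_continuousOn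
    (continuous_combDeriv hf hj).continuousOn
  exact ⟨C, fun lam hlam k hk => hC (lam, k) ⟨by simpa using hlam, by simpa using hk⟩⟩

lemma iteratedFDeriv_comp_combCLM (hf : ContDiff ℝ r f) (hj : j ≤ r) (k : Fin s → V) :
    iteratedFDeriv ℝ j (f ∘ combCLM k) = fun lam => combDeriv f j lam k := by
  funext lam
  exact (combCLM k).iteratedFDeriv_comp_right hf lam hj

lemma hasFDerivAt_combDeriv (hf : ContDiff ℝ r f) (hj : j < r) (lam : Fin s → ℝ)
    (k : Fin s → V) :
    HasFDerivAt (fun lam => combDeriv f j lam k) (combDeriv f (j + 1) lam k).curryLeft lam := by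
  have h := (hf.comp (combCLM k).contDiff).ftaylorSeries.fderiv j hj lam
  simp only [ftaylorSeries] at h
  rwa [iteratedFDeriv_comp_combCLM hf hj.le,
    iteratedFDeriv_comp_combCLM hf (ENat.add_one_natCast_le_withTop_of_lt hj)] at h

variable {Y : Type*} [MeasurableSpace Y] {μ : Measure Y} {κ : Y → Fin s → V} {R : ℝ}

lemma aestronglyMeasurable_combDeriv (hf : ContDiff ℝ r f) (hj : j ≤ r)
    (hκ : AEStronglyMeasurable κ μ) (lam : Fin s → ℝ) :
    AEStronglyMeasurable (fun y => combDeriv f j lam (κ y)) μ :=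
  ((continuous_combDeriv hf hj).comp (Continuous.prodMk_right lam)).comp_aestronglyMeasurable hκ

variable [FiniteDimensional ℝ V] [IsFiniteMeasure μ]

lemma integrable_combDeriv (hf : ContDiff ℝ r f) (hj : j ≤ r) (hκ : AEStronglyMeasurable κ μ)
    (hR : ∀ y, ‖κ y‖ ≤ R) (lam : Fin s → ℝ) :
    Integrable (fun y => combDeriv f j lam (κ y)) μ := by
  obtain ⟨C, hC⟩ := exists_norm_combDeriv_le (s := s) hf hj ‖lam‖ R
  exact Integrable.of_bound (aestronglyMeasurable_combDeriv hf hj hκ lam) C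
    (Eventually.of_forall fun y => hC lam le_rfl _ (hR y))

lemma hasFTaylorSeriesUpTo_integral_comb {r : ℕ∞} (hf : ContDiff ℝ r f)
    (hκ : AEStronglyMeasurable κ μ) (hR : ∀ y, ‖κ y‖ ≤ R) :
    HasFTaylorSeriesUpTo (r : WithTop ℕ∞) (fun lam : Fin s → ℝ => ∫ y, f (∑ i, lam i • κ y i) ∂μ)
      (fun lam j => ∫ y, combDeriv f j lam (κ y) ∂μ) where
  zero_eq lam := by
    have h := (continuousMultilinearCurryFin0 ℝ (Fin s → ℝ)
      F).toContinuousLinearEquiv.integral_comp_comm (μ := μ) fun y => combDeriv f 0 lam (κ y)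
    refine h.symm.trans (integral_congr_ae (Eventually.of_forall fun y => ?_))
    simp [combDeriv, combCLM_apply]
  fderiv j hj lam := by
    have hj1 : ((j + 1 : ℕ) : WithTop ℕ∞) ≤ r := ENat.add_one_natCast_le_withTop_of_lt hj
    obtain ⟨C, hC⟩ := exists_norm_combDeriv_le (s := s) hf hj1 (‖lam‖ + 1) R
    let e : ((Fin s → ℝ) [×(j + 1)]→L[ℝ] F) ≃L[ℝ] (Fin s → ℝ) →L[ℝ] (Fin s → ℝ) [×j]→L[ℝ] F :=
      (continuousMultilinearCurryLeftEquiv ℝ (fun _ : Fin (j + 1) => Fin s → ℝ)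
        F).toContinuousLinearEquiv
    have h := ContinuousLinearEquiv.integral_comp_comm (μ := μ) (𝕜 := ℝ)
      (E := (Fin s → ℝ) [×(j + 1)]→L[ℝ] F) (F := (Fin s → ℝ) →L[ℝ] (Fin s → ℝ) [×j]→L[ℝ] F) e
      fun y => combDeriv f (j + 1) lam (κ y)
    have h2 := hasFDerivAt_integral_of_dominated_of_fderiv_le (μ := μ) (𝕜 := ℝ)
      (F := fun lam y => combDeriv f j lam (κ y))
      (F' := fun lam y => (combDeriv f (j + 1) lam (κ y)).curryLeft) (x₀ := lam)
      (bound := fun _ => C) (Metric.ball_mem_nhds lam one_pos)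
      (Eventually.of_forall (aestronglyMeasurable_combDeriv hf hj.le hκ))
      (integrable_combDeriv hf hj.le hκ hR lam)
      (e.continuous.comp_aestronglyMeasurable (aestronglyMeasurable_combDeriv hf hj1 hκ lam))
      (Eventually.of_forall fun y x hx => ?_) (integrable_const C)
      (Eventually.of_forall fun y x _ => hasFDerivAt_combDeriv hf hj x (κ y))
    · exact h2.congr_fderiv h
    · rw [ContinuousMultilinearMap.curryLeft_norm]
      refine hC x ?_ _ (hR y)
      have h3 := norm_le_norm_add_norm_sub' x lam
      rw [Metric.mem_ball, dist_eq_norm] at hx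
      linarith
  cont j hj := by
    refine continuous_iff_continuousAt.2 fun lam => ?_
    obtain ⟨C, hC⟩ := exists_norm_combDeriv_le (s := s) hf hj (‖lam‖ + 1) R
    refine continuousAt_of_dominated (bound := fun _ => C)
      (Eventually.of_forall (aestronglyMeasurable_combDeriv hf hj hκ)) ?_ (integrable_const C)
      (Eventually.of_forall fun y =>
        ((continuous_combDeriv hf hj).comp (Continuous.prodMk_left (κ y))).continuousAt)
    filter_upwards [Metric.ball_mem_nhds lam one_pos] with x hx
    refine Eventually.of_forall fun y => hC x ?_ _ (hR y)
    have h3 := norm_le_norm_add_norm_sub' x lam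
    rw [Metric.mem_ball, dist_eq_norm] at hx
    linarith

end Comb

lemma tendsto_apply_of_tendstoUniformlyOn_isCompact {X Y ι : Type*} [TopologicalSpace X]
    [WeaklyLocallyCompactSpace X] [UniformSpace Y] {l : Filter ι} {F : ι → X → Y} {f : X → Y}
    (hf : Continuous f) (h : ∀ G : Set X, IsCompact G → TendstoUniformlyOn F f l G) {z : ι → X}
    {z₀ : X} (hz : Tendsto z l (𝓝 z₀)) : Tendsto (fun a => F a (z a)) l (𝓝 (f z₀)) := by
  obtain ⟨G, hG, hGz⟩ := exists_compact_mem_nhds z₀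
  exact tendsto_comp_of_locally_uniform_limit hf.continuousAt hz fun u hu => ⟨G, hGz, h G hG u hu⟩

section Derivatives

variable {X F : Type*} [NormedAddCommGroup X] [NormedSpace ℝ X] [NormedAddCommGroup F]
  [NormedSpace ℝ F] {ι : Type*} {l : Filter ι} {r : ℕ} {x : ι → X} {x₀ : X}

lemma tendsto_iteratedFDeriv_smul {u : X → ℝ} {G : ι → X → F} {G₀ : X → F}
    (hu : ContDiff ℝ r u) (hG : ∀ a, ContDiff ℝ r (G a)) (hG₀ : ContDiff ℝ r G₀)
    (hx : Tendsto x l (𝓝 x₀))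
    (h : ∀ j ≤ r, Tendsto (fun a => iteratedFDeriv ℝ j (G a) (x a)) l
      (𝓝 (iteratedFDeriv ℝ j G₀ x₀))) {j : ℕ} (hj : j ≤ r) :
    Tendsto (fun a => iteratedFDeriv ℝ j (fun y => u y • G a y) (x a)) l
      (𝓝 (iteratedFDeriv ℝ j (fun y => u y • G₀ y) x₀)) := by
  have hle : ∀ {i : ℕ}, i ≤ r → (i : WithTop ℕ∞) ≤ (r : WithTop ℕ∞) := fun hi => by
    exact_mod_cast hi
  have h1 : Tendsto (fun a => iteratedFDeriv ℝ j (fun y => u y • G₀ y) (x a)) l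
      (𝓝 (iteratedFDeriv ℝ j (fun y => u y • G₀ y) x₀)) :=
    (((hu.smul hG₀).continuous_iteratedFDeriv (hle hj)).tendsto x₀).comp hx
  have hsub : ∀ i ≤ r, Tendsto (fun a => iteratedFDeriv ℝ i (fun y => G a y - G₀ y) (x a)) l
      (𝓝 0) := by
    intro i hi
    have h2 := (h i hi).sub (((hG₀.continuous_iteratedFDeriv (hle hi)).tendsto x₀).comp hx)
    rw [sub_self] at h2
    refine h2.congr fun a => ?_
    exact (fun_iteratedFDeriv_sub_apply ((hG a).of_le (hle hi)).contDiffAt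
      (hG₀.of_le (hle hi)).contDiffAt).symm
  have h0 : Tendsto (fun a => iteratedFDeriv ℝ j (fun y => u y • (G a y - G₀ y)) (x a)) l
      (𝓝 0) := by
    refine squeeze_zero_norm (fun a => norm_iteratedFDeriv_smul_le hu ((hG a).sub hG₀) (x a)
      (hle hj)) ?_
    have h3 : ∀ i ∈ Finset.range (j + 1), Tendsto (fun a => (j.choose i : ℝ) *
        ‖iteratedFDeriv ℝ i u (x a)‖ * ‖iteratedFDeriv ℝ (j - i) (fun y => G a y - G₀ y) (x a)‖) l
        (𝓝 ((j.choose i : ℝ) * ‖iteratedFDeriv ℝ i u x₀‖ * 0)) := by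
      intro i hi
      have hi' : i ≤ r := (Nat.lt_succ_iff.1 (Finset.mem_range.1 hi)).trans hj
      refine ((((hu.continuous_iteratedFDeriv (hle hi')).tendsto x₀).comp hx).norm.const_mul
        _).mul ?_
      simpa using (hsub (j - i) ((Nat.sub_le j i).trans hj)).norm
    simpa using tendsto_finsetSum _ h3
  have h4 := h0.add h1
  rw [zero_add] at h4
  refine h4.congr fun a => ?_
  refine (fun_iteratedFDeriv_add_apply ((hu.smul ((hG a).sub hG₀)).of_le (hle hj)).contDiffAt
    ((hu.smul hG₀).of_le (hle hj)).contDiffAt).symm.trans ?_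
  congr 1
  funext y
  exact (smul_add (u y) _ _).symm.trans (congrArg _ (sub_add_cancel _ _))

lemma tendsto_iteratedFDeriv_sum {β : Type*} (S : Finset β) {G : ι → β → X → F} {G₀ : β → X → F}
    {j : ℕ} (hG : ∀ a b, ContDiff ℝ j (G a b)) (hG₀ : ∀ b, ContDiff ℝ j (G₀ b))
    (h : ∀ b, Tendsto (fun a => iteratedFDeriv ℝ j (G a b) (x a)) l
      (𝓝 (iteratedFDeriv ℝ j (G₀ b) x₀))) :
    Tendsto (fun a => iteratedFDeriv ℝ j (fun y => ∑ b ∈ S, G a b y) (x a)) l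
      (𝓝 (iteratedFDeriv ℝ j (fun y => ∑ b ∈ S, G₀ b y) x₀)) := by
  rw [iteratedFDeriv_fun_sum_apply fun b _ => (hG₀ b).contDiffAt]
  refine (tendsto_finsetSum S fun b _ => h b).congr fun a => ?_
  rw [iteratedFDeriv_fun_sum_apply fun b _ => (hG a b).contDiffAt]

end Derivatives

namespace ConvexBody

variable {n s : ℕ} {F : Type*} [NormedAddCommGroup F] [NormedSpace ℝ F]

lemma hasFTaylorSeriesUpTo_integral_decomp {w : Fin s → ℝ} (hw : ∀ i, 0 < w i)
    (K : Fin s → ConvexBody (Euc n)) {r : ℕ∞} {f : Euc n → F} (hf : ContDiff ℝ r f) :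
    HasFTaylorSeriesUpTo (r : WithTop ℕ∞) (fun lam : Fin s → ℝ =>
        ∫ y in (∑ i, w i • (K i : Set (Euc n))), f (∑ i, lam i • decomp w K y i))
      (fun lam j =>
        ∫ y in (∑ i, w i • (K i : Set (Euc n))), combDeriv f j lam (decomp w K y)) := by
  obtain ⟨R, hR0, hR⟩ := exists_boundedBy K
  have : IsFiniteMeasure (volume.restrict (∑ i, w i • (K i : Set (Euc n)) : Set (Euc n))) :=
    isFiniteMeasure_restrict.2 (isCompact_sum_smul w K).measure_ne_top
  exact hasFTaylorSeriesUpTo_integral_comb hf (aestronglyMeasurable_decomp hw K)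
    (norm_decomp_le hR0.le hR)

variable {ι : Type*} {l : Filter ι} {K : Fin s → ConvexBody (Euc n)}
  {Kl : ι → Fin s → ConvexBody (Euc n)} {f : Euc n → F} {fl : ι → Euc n → F} {r j : ℕ}

lemma norm_le_of_mem_sum_smul {w : Fin s → ℝ} {R : ℝ} (hR0 : 0 ≤ R) (hR : BoundedBy K R)
    {y : Euc n} (hy : y ∈ (∑ i, w i • (K i : Set (Euc n)))) : ‖y‖ ≤ s * R * ‖w‖ := by
  obtain ⟨k, hk, rfl⟩ := mem_sum_smul_iff.1 hy
  rw [← combCLM_apply]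
  exact norm_combCLM_apply_le ((pi_norm_le_iff_of_nonneg hR0).2 fun i => hR i _ (hk i)) le_rfl

lemma tendsto_setIntegral_combDeriv [l.IsCountablyGenerated] {w : Fin s → ℝ}
    (hw : ∀ i, 0 < w i) (hfl : ∀ a, ContDiff ℝ r (fl a)) (hf : ContDiff ℝ r f) (hj : j ≤ r)
    (hconv : ∀ G : Set (Euc n), IsCompact G →
      TendstoUniformlyOn (fun a => iteratedFDeriv ℝ j (fl a)) (iteratedFDeriv ℝ j f) l G)
    (hK : ∀ i, Tendsto (fun a => Kl a i) l (𝓝 (K i))) {x : ι → Fin s → ℝ} {x₀ : Fin s → ℝ}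
    (hx : Tendsto x l (𝓝 x₀)) :
    Tendsto (fun a => ∫ y in (∑ i, w i • (Kl a i : Set (Euc n))),
        combDeriv (fl a) j (x a) (decomp w (Kl a) y)) l
      (𝓝 (∫ y in (∑ i, w i • (K i : Set (Euc n))), combDeriv f j x₀ (decomp w K y))) := by
  have hj' : (j : WithTop ℕ∞) ≤ (r : WithTop ℕ∞) := by exact_mod_cast hj
  have hw' := fun i => (hw i).le
  obtain ⟨R, hR0, hR⟩ := exists_boundedBy K
  have hR1 : 0 ≤ R + 1 := by linarith
  have hcont : Continuous (iteratedFDeriv ℝ j f) := hf.continuous_iteratedFDeriv hj'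
  have hmeas : ∀ L : Fin s → ConvexBody (Euc n),
      MeasurableSet (∑ i, w i • (L i : Set (Euc n)) : Set (Euc n)) := fun L =>
    (isCompact_sum_smul w L).measurableSet
  set B := Metric.closedBall (0 : Euc n) (s * (R + 1) * (‖x₀‖ + 1)) with hB
  have hBc : IsCompact B := isCompact_closedBall _ _
  obtain ⟨C, hC⟩ := hBc.exists_bound_of_continuousOn hcont.continuousOn
  set D := Metric.closedBall (0 : Euc n) (s * (R + 1) * ‖w‖) with hD
  simp only [← integral_indicator (hmeas _)]
  refine tendsto_integral_filter_of_dominated_convergence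
    (D.indicator fun _ => (C + 1) * (s * (R + 1)) ^ j) (Eventually.of_forall fun a => ?_) ?_
    ((integrable_indicator_iff Metric.isClosed_closedBall.measurableSet).2
      (integrableOn_const (isCompact_closedBall _ _).measure_ne_top)) ?_
  · exact (aestronglyMeasurable_indicator_iff (hmeas _)).2 (aestronglyMeasurable_combDeriv (hfl a)
      hj' (aestronglyMeasurable_decomp hw (Kl a)) (x a))
  · filter_upwards [eventually_boundedBy hK hR, hx.norm.eventually_lt_const (lt_add_one ‖x₀‖),
      Metric.tendstoUniformlyOn_iff.1 (hconv B hBc) 1 one_pos] with a hRa hxa hua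
    refine Eventually.of_forall fun y => ?_
    by_cases hy : y ∈ (∑ i, w i • (Kl a i : Set (Euc n)))
    · have hyD : y ∈ D := mem_closedBall_zero_iff.2 (norm_le_of_mem_sum_smul hR1 hRa hy)
      rw [indicator_of_mem hy, indicator_of_mem hyD]
      have hd := norm_decomp_le (lam := w) hR1 hRa y
      have hzB : combCLM (decomp w (Kl a) y) (x a) ∈ B :=
        mem_closedBall_zero_iff.2 (norm_combCLM_apply_le hd hxa.le)
      have hle : ‖iteratedFDeriv ℝ j (fl a) (combCLM (decomp w (Kl a) y) (x a))‖ ≤ C + 1 := by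
        have h1 := hC _ hzB
        have h2 := hua _ hzB
        rw [dist_eq_norm'] at h2
        exact (norm_le_norm_add_norm_sub' _ _).trans (add_le_add h1 h2.le)
      refine (norm_combDeriv_le (fl a) j (x a) (decomp w (Kl a) y)).trans ?_
      refine mul_le_mul hle (pow_le_pow_left₀ (by positivity) ?_ j) (by positivity)
        ((norm_nonneg _).trans hle)
      exact mul_le_mul_of_nonneg_left hd (Nat.cast_nonneg s)
    · rw [indicator_of_notMem hy, norm_zero]
      refine indicator_nonneg (fun _ _ => ?_) _
      have hC0 : 0 ≤ C := (norm_nonneg _).trans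
        (hC 0 (Metric.mem_closedBall_self (by positivity)))
      positivity
  · have hfr : ∀ᵐ y : Euc n, y ∉ frontier (∑ i, w i • (K i : Set (Euc n)) : Set (Euc n)) :=
      measure_eq_zero_iff_ae_notMem.1 ((convex_sum_smul w K).addHaar_frontier volume)
    filter_upwards [hfr] with y hyf
    by_cases hy : y ∈ (∑ i, w i • (K i : Set (Euc n)))
    · have hyi : y ∈ interior (∑ i, w i • (K i : Set (Euc n))) := by
        by_contra hn
        exact hyf ⟨subset_closure hy, hn⟩
      obtain ⟨ε, hε, hdeep⟩ := exists_isDeep_of_mem_interior hyi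
      have hdec := tendsto_decomp hw hK (tendsto_const_nhds (x := y)) hyi
      rw [indicator_of_mem hy]
      have hz : Tendsto (fun a => combCLM (decomp w (Kl a) y) (x a)) l
          (𝓝 (combCLM (decomp w K y) x₀)) := tendsto_combCLM_apply hdec hx
      refine (tendsto_compContinuousLinearMap_combCLM
        (tendsto_apply_of_tendstoUniformlyOn_isCompact hcont hconv hz) hdec).congr' ?_
      filter_upwards [eventually_isDeep hw' hK (tendsto_const_nhds (x := y)) hε hdeep] with a ha
      obtain ⟨z, hz⟩ := ha.exists_projComb_eq hw' (half_pos hε)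
      rw [indicator_of_mem (hz ▸ projComb_mem w (Kl a) z)]
      rfl
    · rw [indicator_of_notMem hy]
      refine tendsto_const_nhds.congr' ?_
      filter_upwards [eventually_notMem_sum_smul hw' hK hy] with a ha
      rw [indicator_of_notMem ha]

/-- A smooth extension to `ℝ ^ s` of `lam ↦ ∫ f` over `∑ i, lam i • K i`. -/
def integralExt (f : Euc n → F) (K : Fin s → ConvexBody (Euc n)) (lam : Fin s → ℝ) : F :=
  ∑ g : Fin s → Fin (n + 1), gridBasis g lam •
    ∫ y in (∑ i, gridNode g i • (K i : Set (Euc n))),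
      f (∑ i, lam i • decomp (gridNode g) K y i)

lemma contDiff_integralExt (hf : ContDiff ℝ r f) (K : Fin s → ConvexBody (Euc n)) :
    ContDiff ℝ r (integralExt f K) :=
  ContDiff.sum fun g _ => (contDiff_gridBasis g).smul
    (hasFTaylorSeriesUpTo_integral_decomp (r := r) (gridNode_pos g) K hf).contDiff

lemma tendsto_iteratedFDeriv_integralExt [l.IsCountablyGenerated]
    (hfl : ∀ a, ContDiff ℝ r (fl a)) (hf : ContDiff ℝ r f)
    (hconv : ∀ G : Set (Euc n), IsCompact G → ∀ j ≤ r,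
      TendstoUniformlyOn (fun a => iteratedFDeriv ℝ j (fl a)) (iteratedFDeriv ℝ j f) l G)
    (hK : ∀ i, Tendsto (fun a => Kl a i) l (𝓝 (K i))) {x : ι → Fin s → ℝ} {x₀ : Fin s → ℝ}
    (hx : Tendsto x l (𝓝 x₀)) (hj : j ≤ r) :
    Tendsto (fun a => iteratedFDeriv ℝ j (integralExt (fl a) (Kl a)) (x a)) l
      (𝓝 (iteratedFDeriv ℝ j (integralExt f K) x₀)) := by
  have hle : ∀ {i : ℕ}, i ≤ r → (i : WithTop ℕ∞) ≤ (r : WithTop ℕ∞) := fun hi => by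
    exact_mod_cast hi
  have hT := fun (g : Fin s → Fin (n + 1)) (L : Fin s → ConvexBody (Euc n)) {h : Euc n → F}
    (hh : ContDiff ℝ r h) =>
      hasFTaylorSeriesUpTo_integral_decomp (r := r) (gridNode_pos g) L hh
  refine tendsto_iteratedFDeriv_sum _
    (fun a g => ((contDiff_gridBasis g).smul (hT g (Kl a) (hfl a)).contDiff).of_le (hle hj))
    (fun g => ((contDiff_gridBasis g).smul (hT g K hf).contDiff).of_le (hle hj)) fun g => ?_
  refine tendsto_iteratedFDeriv_smul (contDiff_gridBasis g)
    (fun a => (hT g (Kl a) (hfl a)).contDiff) (hT g K hf).contDiff hx (fun i hi => ?_) hj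
  rw [← (hT g K hf).eq_iteratedFDeriv (hle hi)]
  simp only [← (hT g (Kl _) (hfl _)).eq_iteratedFDeriv (hle hi)]
  exact tendsto_setIntegral_combDeriv (gridNode_pos g) hfl hf hi (fun G hG => hconv G hG i hi) hK hx

lemma uniqueDiffOn_orthant (s : ℕ) : UniqueDiffOn ℝ {lam : Fin s → ℝ | ∀ i, 0 ≤ lam i} := by
  have h : {lam : Fin s → ℝ | ∀ i, 0 ≤ lam i} = univ.pi fun _ => Ici 0 := by
    ext
    simp only [mem_ofPred_eq, mem_univ_pi, mem_Ici]
  rw [h]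
  exact UniqueDiffOn.univ_pi fun _ => uniqueDiffOn_Ici 0

lemma iteratedFDerivWithin_integral_sum_smul (hf : ContDiff ℝ r f) (K : Fin s → ConvexBody (Euc n))
    (hj : j ≤ r) {lam : Fin s → ℝ} (hlam : ∀ i, 0 ≤ lam i) :
    iteratedFDerivWithin ℝ j
      (fun lam : Fin s → ℝ => ∫ x in (∑ i, lam i • (K i : Set (Euc n))), f x)
      {lam : Fin s → ℝ | ∀ i, 0 ≤ lam i} lam = iteratedFDeriv ℝ j (integralExt f K) lam := by
  have h : EqOn (fun lam : Fin s → ℝ => ∫ x in (∑ i, lam i • (K i : Set (Euc n))), f x)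
      (integralExt f K) {lam : Fin s → ℝ | ∀ i, 0 ≤ lam i} := fun μ hμ =>
    integral_sum_smul_eq_sum_gridBasis hμ K hf.continuous
  rw [iteratedFDerivWithin_congr h hlam]
  exact iteratedFDerivWithin_eq_iteratedFDeriv (uniqueDiffOn_orthant s)
    ((contDiff_integralExt hf K).of_le (by exact_mod_cast hj)).contDiffAt hlam

end ConvexBody

end Helpers

/-- If `f_m → f` in `C^r` on compact subsets of `ℝⁿ` and `K_j^{(m)} → K_j` in the Hausdorff
metric, then `λ ↦ ∫_{Σ λ_j K_j^{(m)}} f_m` converges to `λ ↦ ∫_{Σ λ_j K_j} f` in `C^r` on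
compact subsets of the closed orthant (derivatives taken within the orthant, i.e. one-sided
at the boundary). -/
theorem integral_over_minkowski_combination_continuity {n : ℕ} (hn : 1 ≤ n)
    (r : ℕ) (s : ℕ)
    (fm : ℕ → Euc n → ℂ) (f : Euc n → ℂ)
    (hfm : ∀ m, ContDiff ℝ (r : WithTop ℕ∞) (fm m)) (hf : ContDiff ℝ (r : WithTop ℕ∞) f)
    (hconv : ∀ G : Set (Euc n), IsCompact G → ∀ j ≤ r,
      TendstoUniformlyOn (fun (m : ℕ) (x : Euc n) => iteratedFDeriv ℝ j (fm m) x)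
        (iteratedFDeriv ℝ j f) Filter.atTop G)
    (Km : ℕ → Fin s → ConvexBody (Euc n)) (K : Fin s → ConvexBody (Euc n))
    (hK : ∀ j : Fin s, Filter.Tendsto (fun m => Km m j) Filter.atTop (nhds (K j))) :
    ∀ C : Set (Fin s → ℝ), IsCompact C → C ⊆ {lam : Fin s → ℝ | ∀ i, 0 ≤ lam i} →
      ∀ j ≤ r,
      TendstoUniformlyOn
        (fun (m : ℕ) (lam : Fin s → ℝ) =>
          iteratedFDerivWithin ℝ j
            (fun lam : Fin s → ℝ => ∫ x in (∑ i, lam i • (Km m i : Set (Euc n))), fm m x)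
            {lam : Fin s → ℝ | ∀ i, 0 ≤ lam i} lam)
        (iteratedFDerivWithin ℝ j
          (fun lam : Fin s → ℝ => ∫ x in (∑ i, lam i • (K i : Set (Euc n))), f x)
          {lam : Fin s → ℝ | ∀ i, 0 ≤ lam i})
        Filter.atTop C := by
  intro C hC hCO j hj
  suffices h : TendstoUniformlyOn
      (fun m lam => iteratedFDeriv ℝ j (ConvexBody.integralExt (fm m) (Km m)) lam)
      (iteratedFDeriv ℝ j (ConvexBody.integralExt f K)) atTop C by
    refine (h.congr (Eventually.of_forall fun m lam hlam => ?_)).congr_right fun lam hlam => ?_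
    · exact (ConvexBody.iteratedFDerivWithin_integral_sum_smul (hfm m) _ hj (hCO hlam)).symm
    · exact (ConvexBody.iteratedFDerivWithin_integral_sum_smul hf _ hj (hCO hlam)).symm
  rw [← tendstoLocallyUniformlyOn_iff_tendstoUniformlyOn_of_compact hC,
    tendstoLocallyUniformlyOn_iff_forall_tendsto]
  intro lam₀ _
  refine Tendsto.mono_left ?_ (Filter.prod_mono le_rfl nhdsWithin_le_nhds)
  have hc : ∀ G : Set (Euc n), IsCompact G → ∀ i ≤ r, TendstoUniformlyOn
      (fun q : ℕ × (Fin s → ℝ) => iteratedFDeriv ℝ i (fm q.1)) (iteratedFDeriv ℝ i f)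
      (atTop ×ˢ nhds lam₀) G := fun G hG i hi u hu =>
    tendsto_fst.eventually (hconv G hG i hi u hu)
  have hKq : ∀ i, Tendsto (fun q : ℕ × (Fin s → ℝ) => Km q.1 i) (atTop ×ˢ nhds lam₀) (nhds (K i)) :=
    fun i => (hK i).comp tendsto_fst
  have h1 := ConvexBody.tendsto_iteratedFDeriv_integralExt (fun q : ℕ × (Fin s → ℝ) => hfm q.1) hf
    hc hKq tendsto_snd hj
  have h2 : Continuous (iteratedFDeriv ℝ j (ConvexBody.integralExt f K)) :=
    (ConvexBody.contDiff_integralExt hf K).continuous_iteratedFDeriv (by exact_mod_cast hj)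
  exact (((h2.tendsto lam₀).comp tendsto_snd).prodMk_nhds h1).mono_right (nhds_le_uniformity _)
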